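/- Let α, β ∈ (0,1) and μ be real numbers. Then H_μ is twice differentiable on (2, ∞) and for every real λ > 2 one has λ(1−λ)·H_μ″(λ) + (α+β−μ−(α+β−2μ+1)λ)·H_μ′(λ) − (α−μ)(β−μ)·H_μ(λ) = −(λ−1)^{μ−1}, where (λ−1)^{μ−1} is the real power. -/

import Mathlib

open Set

/-- Pochhammer symbol `(a)_n` for real `a`. -/
noncomputable def poch (a : ℝ) (n : ℕ) : ℝ := (ascPochhammer ℝ n).eval a

/-- Generalized hypergeometric function `₃F₂(a₁,a₂,a₃;b₁,b₂;x)` (real version). -/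
noncomputable def hyp3F2 (a₁ a₂ a₃ b₁ b₂ x : ℝ) : ℝ :=
  ∑' n : ℕ, poch a₁ n * poch a₂ n * poch a₃ n /
    (poch b₁ n * poch b₂ n * (n.factorial : ℝ)) * x ^ n

/-- `H_μ(λ) = (1/((1−α)(1−β)))·(λ−1)^{μ−1}·₃F₂(1,1,1−μ;2−α,2−β;1/(1−λ))`. -/
noncomputable def Hfun (α β μ : ℝ) : ℝ → ℝ :=
  fun x => (1 / ((1 - α) * (1 - β))) * (x - 1) ^ (μ - 1) *
    hyp3F2 1 1 (1 - μ) (2 - α) (2 - β) (1 / (1 - x))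

open Filter Topology

/-- Sequences whose consecutive ratios tend to `1`; vanishing terms are allowed. -/
def RatioTendsToOne (b : ℕ → ℝ) : Prop :=
  ∃ q : ℕ → ℝ, Tendsto q atTop (𝓝 1) ∧ ∀ n, b (n + 1) = q n * b n

/-- The coefficients of the formal derivative of `∑ bₙ zⁿ`. -/
def derivCoeff (b : ℕ → ℝ) (n : ℕ) : ℝ := (n + 1) * b (n + 1)

theorem tendsto_add_div_add_atTop (c d : ℝ) :
    Tendsto (fun n : ℕ => ((n : ℝ) + c) / (n + d)) atTop (𝓝 1) := by
  simpa [add_comm] using tendsto_add_mul_div_add_mul_atTop_nhds c d (1 : ℝ) one_ne_zero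

theorem RatioTendsToOne.derivCoeff {b : ℕ → ℝ} (hb : RatioTendsToOne b) :
    RatioTendsToOne (derivCoeff b) := by
  obtain ⟨q, hq, h⟩ := hb
  refine ⟨fun n => ((n : ℝ) + 2) / (n + 1) * q (n + 1), ?_, fun n => ?_⟩
  · simpa using (tendsto_add_div_add_atTop 2 1).mul (hq.comp (tendsto_add_atTop_nat 1))
  · have : (n : ℝ) + 1 ≠ 0 := by positivity
    simp only [_root_.derivCoeff, h (n + 1)]
    push_cast
    field_simp
    ring

theorem RatioTendsToOne.summable {b : ℕ → ℝ} (hb : RatioTendsToOne b) {z : ℝ} (hz : |z| < 1) :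
    Summable fun n => b n * z ^ n := by
  obtain ⟨q, hq, h⟩ := hb
  obtain ⟨r, hzr, hr⟩ := exists_between hz
  have hlim : Tendsto (fun n => |q n| * |z|) atTop (𝓝 |z|) := by
    simpa using hq.abs.mul_const |z|
  refine summable_of_ratio_norm_eventually_le hr ?_
  filter_upwards [hlim.eventually_lt_const hzr] with n hn
  calc ‖b (n + 1) * z ^ (n + 1)‖ = |q n| * |z| * ‖b n * z ^ n‖ := by
        simp only [h n, Real.norm_eq_abs, abs_mul, pow_succ]
        ring
    _ ≤ r * ‖b n * z ^ n‖ := by gcongr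

theorem HasSum.shift_mul_pow {b : ℕ → ℝ} {z L : ℝ} (h : HasSum (fun n => b (n + 1) * z ^ n) L) :
    HasSum (fun n => b n * z ^ n) (b 0 + z * L) := by
  have h' : HasSum (fun n => b (n + 1) * z ^ (n + 1)) (z * L) := by
    refine (h.mul_left z).congr_fun fun n => ?_
    ring
  simpa [add_comm] using (hasSum_nat_add_iff (f := fun n => b n * z ^ n) 1).mp h'

theorem RatioTendsToOne.hasDerivAt_tsum {b : ℕ → ℝ} (hb : RatioTendsToOne b) {z : ℝ}
    (hz : |z| < 1) :
    HasDerivAt (fun w => ∑' n, b n * w ^ n) (∑' n, _root_.derivCoeff b n * z ^ n) z := by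
  obtain ⟨r, hzr, hr⟩ := exists_between hz
  have hr0 : 0 < r := (abs_nonneg z).trans_lt hzr
  have hshift : ∀ w : ℝ, |w| < 1 → Summable fun n : ℕ => b n * (n * w ^ (n - 1)) := by
    intro w hw
    refine (summable_nat_add_iff 1).mp ?_
    refine (hb.derivCoeff.summable hw).congr fun n => ?_
    simp only [_root_.derivCoeff, Nat.add_sub_cancel]
    push_cast
    ring
  have hu : Summable fun n : ℕ => ‖b n * (n * r ^ (n - 1))‖ :=
    (hshift r (by rwa [abs_of_pos hr0])).norm
  have hd := hasDerivAt_tsum_of_isPreconnected (g := fun n w => b n * w ^ n)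
    (g' := fun n w => b n * (n * w ^ (n - 1))) (y₀ := 0) (y := z) hu
    (Metric.isOpen_ball (x := (0 : ℝ)) (ε := r)) (convex_ball (0 : ℝ) r).isPreconnected
    (fun n y _ => (hasDerivAt_pow n y).const_mul (b n))
    (fun n y hy => by
      have hy' : |y| < r := by simpa using hy
      simp only [norm_mul, norm_pow, Real.norm_eq_abs, abs_of_pos hr0]
      gcongr)
    (by simpa using hr0) (hb.summable (by simp)) (by simpa using hzr)
  refine hd.congr_deriv ?_
  rw [(hshift z hz).tsum_eq_zero_add]
  simp [_root_.derivCoeff, mul_comm, mul_left_comm]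

/-- The coefficients of `₃F₂(1, 1, 1 - μ; 2 - α, 2 - β; z)`. -/
noncomputable def hypCoeff (α β μ : ℝ) (n : ℕ) : ℝ :=
  poch 1 n * poch 1 n * poch (1 - μ) n / (poch (2 - α) n * poch (2 - β) n * (n.factorial : ℝ))

theorem poch_succ (a : ℝ) (n : ℕ) : poch a (n + 1) = poch a n * (a + n) := by
  simp [poch, ascPochhammer_succ_right]

theorem poch_pos {a : ℝ} (ha : 0 < a) (n : ℕ) : 0 < poch a n :=
  ascPochhammer_pos n a ha

section

variable {α β : ℝ} (μ : ℝ)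

theorem hypCoeff_succ (hα : α < 1) (hβ : β < 1) (n : ℕ) :
    ((n : ℝ) + 2 - α) * (n + 2 - β) * hypCoeff α β μ (n + 1) =
      (n + 1) * (n + 1 - μ) * hypCoeff α β μ n := by
  have h1 := (poch_pos (a := 2 - α) (by linarith) n).ne'
  have h2 := (poch_pos (a := 2 - β) (by linarith) n).ne'
  have hn : (0 : ℝ) ≤ n := n.cast_nonneg
  have h3 : 2 - α + (n : ℝ) ≠ 0 := by linarith
  have h4 : 2 - β + (n : ℝ) ≠ 0 := by linarith
  have h5 : (n : ℝ) + 1 ≠ 0 := by positivity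
  have h6 : (n.factorial : ℝ) ≠ 0 := by positivity
  simp only [hypCoeff, poch_succ, Nat.factorial_succ]
  push_cast
  field_simp
  ring

theorem ratioTendsToOne_hypCoeff (hα : α < 1) (hβ : β < 1) :
    RatioTendsToOne (hypCoeff α β μ) := by
  refine ⟨fun n => ((n : ℝ) + 1) / (n + (2 - α)) * ((n + (1 - μ)) / (n + (2 - β))), ?_,
    fun n => ?_⟩
  · simpa using (tendsto_add_div_add_atTop 1 (2 - α)).mul
      (tendsto_add_div_add_atTop (1 - μ) (2 - β))
  · have hn : (0 : ℝ) ≤ n := n.cast_nonneg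
    have h3 : (n : ℝ) + (2 - α) ≠ 0 := by linarith
    have h4 : (n : ℝ) + (2 - β) ≠ 0 := by linarith
    have := hypCoeff_succ μ hα hβ n
    field_simp
    linear_combination this

/-- The second-order inhomogeneous equation of `₃F₂(1, 1, 1 - μ; 2 - α, 2 - β; z)`. -/
theorem hypCoeff_tsum_ode (hα : α < 1) (hβ : β < 1) {z : ℝ} (hz : |z| < 1) :
    (1 - α) * (1 - β) * ∑' n, hypCoeff α β μ n * z ^ n
      + (3 - α - β) * (z * ∑' n, derivCoeff (hypCoeff α β μ) n * z ^ n)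
      + z * (z * ∑' n, derivCoeff (derivCoeff (hypCoeff α β μ)) n * z ^ n) =
    (1 - α) * (1 - β) + z * ((1 - μ) * ∑' n, hypCoeff α β μ n * z ^ n
      + (3 - μ) * (z * ∑' n, derivCoeff (hypCoeff α β μ) n * z ^ n)
      + z * (z * ∑' n, derivCoeff (derivCoeff (hypCoeff α β μ)) n * z ^ n)) := by
  set b := hypCoeff α β μ with hb
  have hr : RatioTendsToOne b := ratioTendsToOne_hypCoeff μ hα hβ
  have hA := (hr.summable hz).hasSum
  have hB' := (hr.derivCoeff.summable hz).hasSum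
  have hC' := (hr.derivCoeff.derivCoeff.summable hz).hasSum
  have euler : ∀ {c : ℕ → ℝ} {L : ℝ}, HasSum (fun n => derivCoeff c n * z ^ n) L →
      HasSum (fun n : ℕ => n * c n * z ^ n) (z * L) := by
    intro c L h
    have h' : HasSum (fun n : ℕ => ((n + 1 : ℕ) * c (n + 1)) * z ^ n) L := by
      simpa [derivCoeff] using h
    simpa using HasSum.shift_mul_pow (b := fun n => (n : ℝ) * c n) h'
  have hB := euler hB'
  have hC : HasSum (fun n : ℕ => ((n : ℝ) * (n - 1) * b n) * z ^ n)
      (z * (z * ∑' n, derivCoeff (derivCoeff b) n * z ^ n)) := by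
    have h' := euler hC'
    have h'' : HasSum (fun n : ℕ => (((n + 1 : ℕ) : ℝ) * ((n + 1 : ℕ) - 1) * b (n + 1)) * z ^ n)
        (z * ∑' n, derivCoeff (derivCoeff b) n * z ^ n) := by
      refine h'.congr_fun fun n => ?_
      simp only [derivCoeff]
      push_cast
      ring
    simpa using HasSum.shift_mul_pow (b := fun n => (n : ℝ) * (n - 1) * b n) h''
  have hleft := ((hA.mul_left ((1 - α) * (1 - β))).add (hB.mul_left (3 - α - β))).add hC
  have hright := ((hA.mul_left (1 - μ)).add (hB.mul_left (3 - μ))).add hC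
  have hright' : HasSum (fun n : ℕ => (((n + 1 : ℕ) : ℝ) + 1 - α) * ((n + 1 : ℕ) + 1 - β)
      * b (n + 1) * z ^ n) ((1 - μ) * ∑' n, b n * z ^ n
        + (3 - μ) * (z * ∑' n, derivCoeff b n * z ^ n)
        + z * (z * ∑' n, derivCoeff (derivCoeff b) n * z ^ n)) := by
    refine hright.congr_fun fun n => ?_
    have := hypCoeff_succ μ hα hβ n
    push_cast
    linear_combination z ^ n * this
  have h0 : b 0 = 1 := by simp [hb, hypCoeff, poch]
  have hleft' := HasSum.shift_mul_pow
    (b := fun n : ℕ => ((n : ℝ) + 1 - α) * (n + 1 - β) * b n) hright'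
  have huniq := hleft.unique (hleft'.congr_fun fun n => by ring)
  rw [huniq]
  simp [h0]

end

theorem hasDerivAt_rpow_mul_comp {G : ℝ → ℝ} {G' p x : ℝ} (hx : 1 < x)
    (hG : HasDerivAt G G' (1 / (1 - x))) :
    HasDerivAt (fun y => (y - 1) ^ p * G (1 / (1 - y)))
      ((x - 1) ^ p * (-p * (1 / (1 - x)) * G (1 / (1 - x)) + (1 / (1 - x)) ^ 2 * G')) x := by
  have hs : x - 1 ≠ 0 := by linarith
  have hs' : 1 - x ≠ 0 := by linarith
  have hz : HasDerivAt (fun y : ℝ => 1 / (1 - y)) ((1 / (1 - x)) ^ 2) x := by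
    simpa using ((hasDerivAt_id' x).const_sub 1).fun_inv hs'
  have hp := ((hasDerivAt_id' x).sub_const 1).rpow_const (p := p) (Or.inl hs)
  refine (hp.fun_mul (hG.comp x hz)).congr_deriv ?_
  simp only [Function.comp, Real.rpow_sub_one hs]
  have : 1 - x = -(x - 1) := by ring
  rw [this]
  field_simp

/-- for `α, β ∈ (0,1)` and `μ ∈ ℝ`, `H_μ` is twice differentiable on
`(2,∞)` and satisfies the inhomogeneous hypergeometric equation
`λ(1−λ)H_μ″ + (α+β−μ−(α+β−2μ+1)λ)H_μ′ − (α−μ)(β−μ)H_μ = −(λ−1)^{μ−1}`. -/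
theorem stmt13 (α β μ : ℝ) (hα : α ∈ Ioo (0 : ℝ) 1) (hβ : β ∈ Ioo (0 : ℝ) 1) :
    (∀ x : ℝ, 2 < x → DifferentiableAt ℝ (Hfun α β μ) x ∧
      DifferentiableAt ℝ (deriv (Hfun α β μ)) x) ∧
    ∀ x : ℝ, 2 < x →
      x * (1 - x) * deriv (deriv (Hfun α β μ)) x
        + (α + β - μ - (α + β - 2 * μ + 1) * x) * deriv (Hfun α β μ) x
        - (α - μ) * (β - μ) * Hfun α β μ x = -(x - 1) ^ (μ - 1) := by
  have hr := ratioTendsToOne_hypCoeff μ hα.2 hβ.2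
  set F : ℝ → ℝ := fun z => ∑' n, hypCoeff α β μ n * z ^ n with hF
  set F₁ : ℝ → ℝ := fun z => ∑' n, derivCoeff (hypCoeff α β μ) n * z ^ n with hF₁
  set F₂ : ℝ → ℝ := fun z => ∑' n, derivCoeff (derivCoeff (hypCoeff α β μ)) n * z ^ n with hF₂
  set K : ℝ := 1 / ((1 - α) * (1 - β)) with hK
  have hz : ∀ x : ℝ, 2 < x → |1 / (1 - x)| < 1 := by
    intro x hx
    rw [abs_div, abs_one, abs_of_neg (by linarith), div_lt_one (by linarith)]
    linarith
  have hH : Hfun α β μ = fun x => K * ((x - 1) ^ (μ - 1) * F (1 / (1 - x))) := by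
    ext x
    simp only [Hfun, hyp3F2, hypCoeff, hF, hK, mul_assoc]
  set G : ℝ → ℝ := fun w => -(μ - 1) * w * F w + w ^ 2 * F₁ w with hG
  have hd : ∀ x : ℝ, 2 < x →
      HasDerivAt (Hfun α β μ) (K * ((x - 1) ^ (μ - 1) * G (1 / (1 - x)))) x := by
    intro x hx
    rw [hH]
    exact (hasDerivAt_rpow_mul_comp (by linarith) (hr.hasDerivAt_tsum (hz x hx))).const_mul K
  set G₁ : ℝ → ℝ := fun w => -(μ - 1) * F w + -(μ - 1) * w * F₁ w
    + (2 * w * F₁ w + w ^ 2 * F₂ w) with hG₁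
  have hGd : ∀ w : ℝ, |w| < 1 → HasDerivAt G (G₁ w) w := by
    intro w hw
    have h₁ := ((hasDerivAt_id' w).const_mul (-(μ - 1))).fun_mul (hr.hasDerivAt_tsum hw)
    have h₂ := (hasDerivAt_pow 2 w).fun_mul (hr.derivCoeff.hasDerivAt_tsum hw)
    refine (h₁.fun_add h₂).congr_deriv ?_
    simp [hG₁, hF, hF₁, hF₂]
  have hd₂ : ∀ x : ℝ, 2 < x → HasDerivAt (deriv (Hfun α β μ))
      (K * ((x - 1) ^ (μ - 1) * (-(μ - 1) * (1 / (1 - x)) * G (1 / (1 - x))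
        + (1 / (1 - x)) ^ 2 * G₁ (1 / (1 - x))))) x := by
    intro x hx
    have hev : deriv (Hfun α β μ) =ᶠ[𝓝 x]
        fun y => K * ((y - 1) ^ (μ - 1) * G (1 / (1 - y))) := by
      filter_upwards [lt_mem_nhds hx] with y hy using (hd y hy).deriv
    exact ((hasDerivAt_rpow_mul_comp (by linarith)
      (hGd _ (hz x hx))).const_mul K).congr_of_eventuallyEq hev
  refine ⟨fun x hx => ⟨(hd x hx).differentiableAt, (hd₂ x hx).differentiableAt⟩, fun x hx => ?_⟩
  have hode := hypCoeff_tsum_ode μ hα.2 hβ.2 (hz x hx)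
  rw [(hd₂ x hx).deriv, (hd x hx).deriv, hH]
  simp only [hG, hG₁, hF, hF₁, hF₂]
  have hw : 1 / (1 - x) ≠ 0 := one_div_ne_zero (by linarith)
  have hxw : x = 1 - 1 / (1 / (1 - x)) := by simp
  have hα' : 1 - α ≠ 0 := by linarith [hα.2]
  have hβ' : 1 - β ≠ 0 := by linarith [hβ.2]
  generalize (x - 1) ^ (μ - 1) = P
  generalize 1 / (1 - x) = w at *
  generalize ∑' n, hypCoeff α β μ n * w ^ n = A at *
  generalize ∑' n, derivCoeff (hypCoeff α β μ) n * w ^ n = B at *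
  generalize ∑' n, derivCoeff (derivCoeff (hypCoeff α β μ)) n * w ^ n = C at *
  rw [hxw, hK]
  field_simp
  linear_combination (-P) * hode
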